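/- For all τ in the complex upper half-plane ℍ and all z ∈ ℂ, one has 2·φ_{0,1}(τ,z) = (1/2)·(ϑ_3(τ,z)²/ϑ_3(τ,0)²)·Δ(τ)²/(Δ(2τ)·Δ(τ/2)) − (1/2)·(ϑ_4(τ,z)²/ϑ_4(τ,0)²)·Δ(τ/2)/Δ(τ) − 2^{11}·(ϑ_2(τ,z)²/ϑ_2(τ,0)²)·Δ(2τ)/Δ(τ). (The left-hand side is the K3 elliptic genus Z_{K3}(τ,z).) -/

import Mathlib

noncomputable section

open Complex

/-- `2πi`. -/
def twoPiI : ℂ := 2 * Real.pi * Complex.I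

/-- `q = e^{2πiτ}`. -/
def qq (τ : ℂ) : ℂ := Complex.exp (twoPiI * τ)

/-- `y = e^{2πiz}`. -/
def yy (z : ℂ) : ℂ := Complex.exp (twoPiI * z)

/-- Jacobi theta function `ϑ₁`. -/
def th1 (τ z : ℂ) : ℂ :=
  -Complex.I * ∑' n : ℤ, (-1 : ℂ) ^ n *
    Complex.exp (twoPiI * (((n : ℂ) + 1/2) * z + ((n : ℂ) + 1/2) ^ 2 / 2 * τ))

/-- Jacobi theta function `ϑ₂`. -/
def th2 (τ z : ℂ) : ℂ :=
  ∑' n : ℤ, Complex.exp (twoPiI * (((n : ℂ) + 1/2) * z + ((n : ℂ) + 1/2) ^ 2 / 2 * τ))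

/-- Jacobi theta function `ϑ₃`. -/
def th3 (τ z : ℂ) : ℂ :=
  ∑' n : ℤ, Complex.exp (twoPiI * ((n : ℂ) * z + (n : ℂ) ^ 2 / 2 * τ))

/-- Jacobi theta function `ϑ₄`. -/
def th4 (τ z : ℂ) : ℂ :=
  ∑' n : ℤ, (-1 : ℂ) ^ n * Complex.exp (twoPiI * ((n : ℂ) * z + (n : ℂ) ^ 2 / 2 * τ))

/-- The Dedekind eta function `η(τ) = q^{1/24} ∏_{n≥1} (1 - qⁿ)`. -/
def etaF (τ : ℂ) : ℂ :=
  Complex.exp (twoPiI * τ / 24) * ∏' n : ℕ, (1 - qq τ ^ (n + 1))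

/-- The quasimodular Eisenstein series `E₂(τ) = 1 - 24 ∑_{n≥1} σ₁(n) qⁿ`. -/
def E2 (τ : ℂ) : ℂ :=
  1 - 24 * ∑' n : ℕ, (∑ d ∈ Nat.divisors (n + 1), (d : ℂ)) * qq τ ^ (n + 1)

/-- `Λ_N(τ) = (N/24)(N E₂(Nτ) - E₂(τ))`. -/
def Lam (N : ℕ) (τ : ℂ) : ℂ := (N : ℂ) / 24 * ((N : ℂ) * E2 ((N : ℂ) * τ) - E2 τ)

/-- The weak Jacobi form `φ_{0,1}`. -/
def phi01 (τ z : ℂ) : ℂ :=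
  4 * (th2 τ z ^ 2 / th2 τ 0 ^ 2 + th3 τ z ^ 2 / th3 τ 0 ^ 2 + th4 τ z ^ 2 / th4 τ 0 ^ 2)

/-- The weak Jacobi form `φ_{-2,1}`. -/
def phim21 (τ z : ℂ) : ℂ := -(th1 τ z ^ 2) / etaF τ ^ 6

/-- `Δ(τ) = η(τ)²⁴`. -/
def Delta (τ : ℂ) : ℂ := etaF τ ^ 24

open Filter Topology

/-- The finite product `(q; q)_n = ∏_{j=1}^n (1 - q^j)`. -/
def qPoch (q : ℂ) (n : ℕ) : ℂ := ∏ j ∈ Finset.range n, (1 - q ^ (j + 1))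

/-- `1 / (q; q)_m` for an integer `m`, understood as `0` for `m < 0`. -/
def invQPoch (q : ℂ) (m : ℤ) : ℂ := if 0 ≤ m then (qPoch q m.toNat)⁻¹ else 0

/-- The Euler product `∏_{n ≥ 1} (1 - q^n)`. -/
def eulerProd (q : ℂ) : ℂ := ∏' n : ℕ, (1 - q ^ (n + 1))

lemma norm_sq_lt_one {p : ℂ} (hp : ‖p‖ < 1) : ‖p ^ 2‖ < 1 := by
  rw [norm_pow]; exact pow_lt_one₀ (norm_nonneg _) hp two_ne_zero

lemma one_add_mul_pow_ne_zero {q : ℂ} (hq : ‖q‖ < 1) {c : ℂ} (hc : ‖c‖ ≤ 1) {n : ℕ}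
    (hn : n ≠ 0) : 1 + c * q ^ n ≠ 0 := by
  intro h
  have h1 : c * q ^ n = -1 := by linear_combination h
  have h2 : ‖c * q ^ n‖ = 1 := by rw [h1]; simp
  rw [norm_mul, norm_pow] at h2
  have h3 : ‖q‖ ^ n < 1 := pow_lt_one₀ (norm_nonneg _) hq hn
  have h4 : ‖c‖ * ‖q‖ ^ n ≤ 1 * ‖q‖ ^ n := by gcongr
  linarith

lemma one_sub_pow_succ_ne_zero {q : ℂ} (hq : ‖q‖ < 1) (n : ℕ) : 1 - q ^ (n + 1) ≠ 0 := by
  simpa [sub_eq_add_neg] using one_add_mul_pow_ne_zero hq (c := -1) (by simp) n.succ_ne_zero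

lemma qPoch_ne_zero {q : ℂ} (hq : ‖q‖ < 1) (n : ℕ) : qPoch q n ≠ 0 :=
  Finset.prod_ne_zero_iff.mpr fun j _ ↦ one_sub_pow_succ_ne_zero hq j

lemma summable_norm_mul_pow {q : ℂ} (hq : ‖q‖ < 1) (c : ℂ) {a : ℕ} (ha : a ≠ 0) (b : ℕ) :
    Summable fun n : ℕ ↦ ‖c * q ^ (a * n + b)‖ := by
  have h : Summable fun n : ℕ ↦ (‖c‖ * ‖q‖ ^ b) * (‖q‖ ^ a) ^ n :=
    (summable_geometric_of_lt_one (by positivity)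
      (pow_lt_one₀ (norm_nonneg _) hq ha)).mul_left _
  refine h.congr fun n ↦ ?_
  rw [norm_mul, norm_pow, pow_add, pow_mul]
  ring

lemma multipliable_one_add_mul_pow {q : ℂ} (hq : ‖q‖ < 1) (c : ℂ) {a : ℕ} (ha : a ≠ 0) (b : ℕ) :
    Multipliable fun n : ℕ ↦ 1 + c * q ^ (a * n + b) :=
  multipliable_one_add_of_summable (summable_norm_mul_pow hq c ha b)

lemma multipliable_one_sub_pow_mul_add {q : ℂ} (hq : ‖q‖ < 1) {a : ℕ} (ha : a ≠ 0) (b : ℕ) :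
    Multipliable fun n : ℕ ↦ 1 - q ^ (a * n + b) := by
  simpa [sub_eq_add_neg] using multipliable_one_add_mul_pow hq (-1) ha b

lemma eulerProd_ne_zero {q : ℂ} (hq : ‖q‖ < 1) : eulerProd q ≠ 0 := by
  have h := tprod_one_add_ne_zero_of_summable (f := fun n : ℕ ↦ -q ^ (n + 1))
    (fun n ↦ by simpa [sub_eq_add_neg] using one_sub_pow_succ_ne_zero hq n)
    (by simpa using summable_norm_mul_pow hq (-1) one_ne_zero 1)
  simpa [eulerProd, sub_eq_add_neg] using h

lemma tendsto_qPoch {q : ℂ} (hq : ‖q‖ < 1) :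
    Tendsto (qPoch q) atTop (𝓝 (eulerProd q)) :=
  (ModularForm.multipliable_one_sub_pow hq).tendsto_prod_tprod_nat

lemma invQPoch_sub_one {q : ℂ} (hq : ‖q‖ < 1) (m : ℤ) :
    invQPoch q (m - 1) = (1 - q ^ m) * invQPoch q m := by
  rcases lt_trichotomy m 0 with h | rfl | h
  · rw [invQPoch, invQPoch, if_neg (by lia), if_neg (by lia), mul_zero]
  · simp [invQPoch]
  · obtain ⟨n, rfl⟩ : ∃ n : ℕ, m = n + 1 := ⟨(m - 1).toNat, by lia⟩
    have h1 : ((n : ℤ) + 1).toNat = n + 1 := by lia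
    have h2 : (0 : ℤ) ≤ n + 1 := by lia
    have h3 := one_sub_pow_succ_ne_zero hq n
    have h4 := qPoch_ne_zero hq n
    have h5 : q ^ ((n : ℤ) + 1) = q ^ (n + 1) := by exact_mod_cast zpow_natCast q (n + 1)
    simp only [invQPoch, add_sub_cancel_right, Int.natCast_nonneg, if_true, Int.toNat_natCast, h1,
      h2, h5]
    rw [qPoch, qPoch, Finset.prod_range_succ, mul_inv]
    field_simp

lemma tendsto_invQPoch {q : ℂ} (hq : ‖q‖ < 1) :
    Tendsto (invQPoch q) atTop (𝓝 (eulerProd q)⁻¹) := by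
  have h1 : Tendsto (fun m : ℤ ↦ (qPoch q m.toNat)⁻¹) atTop (𝓝 (eulerProd q)⁻¹) := by
    refine ((tendsto_qPoch hq).comp ?_).inv₀ (eulerProd_ne_zero hq)
    exact tendsto_atTop.mpr fun b ↦ (eventually_ge_atTop (b : ℤ)).mono fun m hm ↦ by lia
  refine h1.congr' ((eventually_ge_atTop 0).mono fun m hm ↦ ?_)
  simp [invQPoch, hm]

lemma exists_norm_invQPoch_le {q : ℂ} (hq : ‖q‖ < 1) : ∃ C : ℝ, ∀ m, ‖invQPoch q m‖ ≤ C := by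
  have h := ((tendsto_qPoch hq).inv₀ (eulerProd_ne_zero hq)).norm.bddAbove_range
  obtain ⟨C, hC⟩ := h
  have hC' (n : ℕ) : ‖(qPoch q n)⁻¹‖ ≤ C := hC ⟨n, rfl⟩
  refine ⟨C, fun m ↦ ?_⟩
  unfold invQPoch
  split_ifs
  · exact hC' _
  · simpa using (norm_nonneg _).trans (hC' 0)

/-- The finite form of the Jacobi triple product identity. -/
lemma hasSum_finite_jacobi_triple {p : ℂ} (hp0 : p ≠ 0) (hp : ‖p‖ < 1) {x : ℂ} (hx : x ≠ 0)
    (N : ℕ) :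
    HasSum (fun k : ℤ ↦ invQPoch (p ^ 2) (N + k) * invQPoch (p ^ 2) (N - k) * (p ^ k ^ 2 * x ^ k))
      ((∏ j ∈ Finset.range N, (1 + x * p ^ (2 * j + 1)) * (1 + x⁻¹ * p ^ (2 * j + 1)))
        / qPoch (p ^ 2) (2 * N)) := by
  have hq := norm_sq_lt_one hp
  induction N with
  | zero =>
    have h := hasSum_single (f := fun k : ℤ ↦ invQPoch (p ^ 2) ((0 : ℕ) + k) *
      invQPoch (p ^ 2) ((0 : ℕ) - k) * (p ^ k ^ 2 * x ^ k)) 0 (fun k hk ↦ by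
        rcases lt_or_gt_of_ne hk with h | h
        · simp [invQPoch, h]
        · simp [invQPoch, h])
    simpa [invQPoch, qPoch] using h
  | succ N ih =>
    have h1 := (Equiv.addRight (-1 : ℤ)).hasSum_iff.mpr ih
    have h2 := (Equiv.addRight (1 : ℤ)).hasSum_iff.mpr ih
    have h3 := (((ih.mul_left (1 + p ^ (4 * N + 2))).add
      (h1.mul_left (p ^ (2 * N + 1) * x))).add (h2.mul_left (p ^ (2 * N + 1) * x⁻¹))).mul_left
      ((1 - p ^ (4 * N + 2)) * (1 - p ^ (4 * N + 4)))⁻¹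
    have e1 := one_sub_pow_succ_ne_zero hq (2 * N)
    have e2 := one_sub_pow_succ_ne_zero hq (2 * N + 1)
    have e1' : (p ^ 2) ^ (2 * N + 1) = p ^ (4 * N + 2) := by rw [← pow_mul]; ring_nf
    have e2' : (p ^ 2) ^ (2 * N + 1 + 1) = p ^ (4 * N + 4) := by rw [← pow_mul]; ring_nf
    rw [e1'] at e1
    rw [e2'] at e2
    convert! h3 using 1
    · funext k
      simp only [Function.comp_apply, Equiv.coe_addRight]
      have hA1 := invQPoch_sub_one hq (N + 1 + k)
      have hA2 := invQPoch_sub_one hq (N + k)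
      have hB1 := invQPoch_sub_one hq (N + 1 - k)
      have hB2 := invQPoch_sub_one hq (N - k)
      rw [show (N + 1 + k - 1 : ℤ) = N + k by ring] at hA1
      rw [show (N + 1 - k - 1 : ℤ) = N - k by ring] at hB1
      rw [show (N + (k + -1) : ℤ) = N + k - 1 by ring, show (N + (k + 1) : ℤ) = N + 1 + k by ring,
        show (N - (k + -1) : ℤ) = N + 1 - k by ring, show (N - (k + 1) : ℤ) = N - k - 1 by ring,
        hA2, hB2, hA1, hB1]
      push_cast
      set A := invQPoch (p ^ 2) (N + 1 + k)
      set B := invQPoch (p ^ 2) (N + 1 - k)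
      have z1 : (p ^ 2) ^ (N + 1 + k : ℤ) = p ^ (2 * N + 2) * (p ^ k) ^ 2 := by
        rw [← zpow_natCast p 2, ← zpow_natCast (p ^ k), ← zpow_mul, ← zpow_mul, ← zpow_natCast,
          ← zpow_add₀ hp0]
        push_cast; ring_nf
      have z2 : (p ^ 2) ^ (N + k : ℤ) = p ^ (2 * N) * (p ^ k) ^ 2 := by
        rw [← zpow_natCast p 2, ← zpow_natCast (p ^ k), ← zpow_mul, ← zpow_mul, ← zpow_natCast,
          ← zpow_add₀ hp0]
        push_cast; ring_nf
      have z3 : (p ^ 2) ^ (N + 1 - k : ℤ) = p ^ (2 * N + 2) * ((p ^ k) ^ 2)⁻¹ := by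
        rw [← zpow_natCast p 2, ← zpow_natCast (p ^ k), ← zpow_mul, ← zpow_mul, ← zpow_natCast,
          ← zpow_neg, ← zpow_add₀ hp0]
        push_cast; ring_nf
      have z4 : (p ^ 2) ^ (N - k : ℤ) = p ^ (2 * N) * ((p ^ k) ^ 2)⁻¹ := by
        rw [← zpow_natCast p 2, ← zpow_natCast (p ^ k), ← zpow_mul, ← zpow_mul, ← zpow_natCast,
          ← zpow_neg, ← zpow_add₀ hp0]
        push_cast; ring_nf
      have z5 : p ^ ((k + -1) ^ 2) = p ^ k ^ 2 * ((p ^ k) ^ 2)⁻¹ * p := by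
        rw [← zpow_natCast (p ^ k), ← zpow_mul, ← zpow_neg, ← zpow_add₀ hp0, ← zpow_add_one₀ hp0]
        push_cast; ring_nf
      have z6 : p ^ ((k + 1) ^ 2) = p ^ k ^ 2 * (p ^ k) ^ 2 * p := by
        rw [← zpow_natCast (p ^ k), ← zpow_mul, ← zpow_add₀ hp0, ← zpow_add_one₀ hp0]
        push_cast; ring_nf
      have z7 : x ^ (k + -1) = x ^ k * x⁻¹ := by rw [zpow_add₀ hx, zpow_neg_one]
      have z8 : x ^ (k + 1) = x ^ k * x := zpow_add_one₀ hx k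
      rw [z1, z2, z3, z4, z5, z6, z7, z8]
      have hk : p ^ k ≠ 0 := zpow_ne_zero _ hp0
      generalize p ^ k = K at *
      generalize p ^ k ^ 2 = L
      generalize x ^ k = X
      rw [eq_inv_mul_iff_mul_eq₀ (mul_ne_zero e1 e2)]
      rw [show 4 * N + 2 = N * 4 + 2 by ring, show 4 * N + 4 = N * 4 + 4 by ring]
      simp only [pow_add, pow_mul, mul_comm 2 N]
      rw [show (p ^ N) ^ 4 = ((p ^ N) ^ 2) ^ 2 by ring]
      generalize (p ^ N) ^ 2 = M
      field_simp
      ring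
    · rw [Finset.prod_range_succ, show 2 * (N + 1) = 2 * N + 1 + 1 by ring]
      have h5 := qPoch_ne_zero hq (2 * N)
      rw [qPoch] at h5
      rw [qPoch, qPoch, Finset.prod_range_succ, Finset.prod_range_succ, e1', e2']
      field_simp
      ring

/-- The Jacobi triple product identity. -/
theorem jacobi_triple_product {p : ℂ} (hp0 : p ≠ 0) (hp : ‖p‖ < 1) {x : ℂ} (hx : x ≠ 0)
    (hs : Summable fun k : ℤ ↦ ‖p ^ k ^ 2 * x ^ k‖) :
    ∑' k : ℤ, p ^ k ^ 2 * x ^ k =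
      eulerProd (p ^ 2) * (∏' n : ℕ, (1 + x * p ^ (2 * n + 1))) *
        ∏' n : ℕ, (1 + x⁻¹ * p ^ (2 * n + 1)) := by
  have hq := norm_sq_lt_one hp
  have hE := eulerProd_ne_zero hq
  obtain ⟨C, hC⟩ := exists_norm_invQPoch_le hq
  have h1 : Tendsto (fun N : ℕ ↦ ∑' k : ℤ, invQPoch (p ^ 2) (N + k) * invQPoch (p ^ 2) (N - k) *
      (p ^ k ^ 2 * x ^ k)) atTop
      (𝓝 (∑' k : ℤ, (eulerProd (p ^ 2))⁻¹ * (eulerProd (p ^ 2))⁻¹ * (p ^ k ^ 2 * x ^ k))) := by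
    refine tendsto_tsum_of_dominated_convergence (hs.mul_left (C * C)) (fun k ↦ ?_)
      (Eventually.of_forall fun N k ↦ ?_)
    · refine Tendsto.mul_const _ (Tendsto.mul ?_ ?_)
      · exact (tendsto_invQPoch hq).comp
          (tendsto_atTop_add_const_right _ k tendsto_natCast_atTop_atTop)
      · exact (tendsto_invQPoch hq).comp
          (tendsto_atTop_add_const_right _ (-k) tendsto_natCast_atTop_atTop)
    · rw [norm_mul, norm_mul]
      have := (norm_nonneg _).trans (hC 0)
      gcongr
      · exact hC _
      · exact hC _
  have h2 := ((multipliable_one_add_mul_pow hp x two_ne_zero 1).tendsto_prod_tprod_nat.mul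
    (multipliable_one_add_mul_pow hp x⁻¹ two_ne_zero 1).tendsto_prod_tprod_nat).div
    ((tendsto_qPoch hq).comp (tendsto_id.const_mul_atTop' two_pos)) hE
  have h3 := tendsto_nhds_unique h1 (h2.congr fun N ↦ by
    rw [(hasSum_finite_jacobi_triple hp0 hp hx N).tsum_eq]
    simp [Finset.prod_mul_distrib])
  rw [tsum_mul_left] at h3
  rw [← mul_inv, inv_mul_eq_iff_eq_mul₀ (mul_ne_zero hE hE)] at h3
  rw [h3, mul_assoc, mul_div_cancel₀ _ hE, mul_assoc]

lemma eulerProd_eq_mul_odd {p : ℂ} (hp : ‖p‖ < 1) :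
    eulerProd p = eulerProd (p ^ 2) * ∏' n : ℕ, (1 - p ^ (2 * n + 1)) := by
  have h := tprod_even_mul_odd (f := fun n : ℕ ↦ 1 - p ^ (n + 1))
    (multipliable_one_sub_pow_mul_add hp two_ne_zero 1)
    (multipliable_one_sub_pow_mul_add hp two_ne_zero 2)
  rw [eulerProd, eulerProd, ← h, mul_comm]
  congr 1
  exact tprod_congr fun n ↦ by rw [← pow_mul]; ring_nf

lemma eulerProd_sq_eq_mul {p : ℂ} (hp : ‖p‖ < 1) :
    eulerProd (p ^ 2) = eulerProd p * ∏' n : ℕ, (1 + p ^ (n + 1)) := by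
  have h := (ModularForm.multipliable_one_sub_pow hp).tprod_mul
    (by simpa using multipliable_one_add_mul_pow hp 1 one_ne_zero 1 :
      Multipliable fun n : ℕ ↦ 1 + p ^ (n + 1))
  rw [eulerProd, eulerProd, ← h]
  exact tprod_congr fun n ↦ by ring

lemma tprod_odd_mul_tprod_odd {p : ℂ} (hp : ‖p‖ < 1) :
    (∏' n : ℕ, (1 - p ^ (2 * n + 1))) * ∏' n : ℕ, (1 + p ^ (2 * n + 1)) =
      ∏' n : ℕ, (1 - (p ^ 2) ^ (2 * n + 1)) := by
  rw [← (multipliable_one_sub_pow_mul_add hp two_ne_zero 1).tprod_mul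
    (by simpa using multipliable_one_add_mul_pow hp 1 two_ne_zero 1 :
      Multipliable fun n : ℕ ↦ 1 + p ^ (2 * n + 1))]
  exact tprod_congr fun n ↦ by ring

/-- `ϑ₄` as an Euler product quotient. -/
lemma tsum_neg_one_eulerProd {p : ℂ} (hp0 : p ≠ 0) (hp : ‖p‖ < 1)
    (hs : Summable fun k : ℤ ↦ ‖p ^ k ^ 2 * (-1 : ℂ) ^ k‖) :
    (∑' k : ℤ, p ^ k ^ 2 * (-1 : ℂ) ^ k) * eulerProd (p ^ 2) = eulerProd p ^ 2 := by
  rw [jacobi_triple_product hp0 hp (by norm_num) hs, eulerProd_eq_mul_odd hp]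
  simp only [inv_neg, inv_one, neg_one_mul, ← sub_eq_add_neg]
  ring

/-- `ϑ₃` as an Euler product quotient. -/
lemma tsum_one_eulerProd {p : ℂ} (hp0 : p ≠ 0) (hp : ‖p‖ < 1)
    (hs : Summable fun k : ℤ ↦ ‖p ^ k ^ 2 * (1 : ℂ) ^ k‖) :
    (∑' k : ℤ, p ^ k ^ 2 * (1 : ℂ) ^ k) * (eulerProd p ^ 2 * eulerProd (p ^ 4) ^ 2) =
      eulerProd (p ^ 2) ^ 5 := by
  have h1 := eulerProd_eq_mul_odd hp
  have h2 := eulerProd_eq_mul_odd (norm_sq_lt_one hp)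
  have h3 := tprod_odd_mul_tprod_odd hp
  rw [← pow_mul] at h2
  rw [← h3] at h2
  rw [jacobi_triple_product hp0 hp one_ne_zero hs, h1]
  simp only [inv_one, one_mul]
  linear_combination (-(eulerProd (p ^ 2) ^ 3) * (eulerProd (p ^ 2) + eulerProd (p ^ (2 * 2)) *
    ((∏' n : ℕ, (1 - p ^ (2 * n + 1))) * ∏' n : ℕ, (1 + p ^ (2 * n + 1))))) * h2

/-- `ϑ₂` as an Euler product quotient. -/
lemma tsum_self_eulerProd {p : ℂ} (hp0 : p ≠ 0) (hp : ‖p‖ < 1)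
    (hs : Summable fun k : ℤ ↦ ‖p ^ k ^ 2 * p ^ k‖) :
    (∑' k : ℤ, p ^ k ^ 2 * p ^ k) * eulerProd (p ^ 2) = 2 * eulerProd (p ^ 4) ^ 2 := by
  have h := eulerProd_sq_eq_mul (norm_sq_lt_one hp)
  rw [← pow_mul] at h
  have e1 : ∏' n : ℕ, (1 + p * p ^ (2 * n + 1)) = ∏' n : ℕ, (1 + (p ^ 2) ^ (n + 1)) :=
    tprod_congr fun n ↦ by rw [← pow_mul]; ring_nf
  have e2 : ∏' n : ℕ, (1 + p⁻¹ * p ^ (2 * n + 1)) = 2 * ∏' n : ℕ, (1 + (p ^ 2) ^ (n + 1)) := by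
    have h1 : ∀ n : ℕ, 1 + p⁻¹ * p ^ (2 * n + 1) = 1 + (p ^ 2) ^ n := fun n ↦ by
      rw [← pow_mul, pow_succ]; field_simp
    have h2 : Multipliable fun n : ℕ ↦ 1 + (p ^ 2) ^ (n + 1) := by
      simpa using multipliable_one_add_mul_pow (norm_sq_lt_one hp) 1 one_ne_zero 1
    simp_rw [h1]
    rw [tprod_eq_zero_mul' (f := fun n : ℕ ↦ 1 + (p ^ 2) ^ n) h2]
    norm_num
  rw [jacobi_triple_product hp0 hp hp0 hs, e1, e2, h]
  ring

/-- Splitting a sum over pairs of integers by the parity of `m + n`. -/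
lemma tsum_int_prod_eq_parity {F : ℤ × ℤ → ℂ} (hF : Summable F) :
    ∑' z, F z = ∑' z : ℤ × ℤ, F (z.1 + z.2, z.1 - z.2) +
      ∑' z : ℤ × ℤ, F (z.1 + z.2 + 1, z.1 - z.2) := by
  let g : (ℤ × ℤ) ⊕ (ℤ × ℤ) → ℤ × ℤ :=
    Sum.elim (fun z ↦ (z.1 + z.2, z.1 - z.2)) (fun z ↦ (z.1 + z.2 + 1, z.1 - z.2))
  have hg : Function.Bijective g := by
    constructor
    · rintro (⟨a, b⟩ | ⟨a, b⟩) (⟨c, d⟩ | ⟨c, d⟩) h <;> simp [g] at h ⊢ <;> lia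
    · rintro ⟨m, n⟩
      rcases Int.even_or_odd (m + n) with ⟨r, hr⟩ | ⟨r, hr⟩
      · exact ⟨Sum.inl (r, m - r), by simp [g]; lia⟩
      · exact ⟨Sum.inr (r, m - r - 1), by simp [g]; lia⟩
  have hs : Summable (F ∘ g) := hF.comp_injective hg.injective
  rw [← (Equiv.ofBijective g hg).tsum_eq F]
  exact Summable.tsum_sum (hs.comp_injective Sum.inl_injective)
    (hs.comp_injective Sum.inr_injective)

/-- The general term of `ϑ₃`. -/
def th3Term (τ z : ℂ) (n : ℤ) : ℂ := exp (twoPiI * ((n : ℂ) * z + (n : ℂ) ^ 2 / 2 * τ))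

/-- The general term of `ϑ₂`. -/
def th2Term (τ z : ℂ) (n : ℤ) : ℂ :=
  exp (twoPiI * (((n : ℂ) + 1/2) * z + ((n : ℂ) + 1/2) ^ 2 / 2 * τ))

lemma summable_norm_th3Term {τ : ℂ} (hτ : 0 < τ.im) (z : ℂ) :
    Summable fun n ↦ ‖th3Term τ z n‖ := by
  refine ((summable_jacobiTheta₂_term_iff z τ).mpr hτ).norm.congr fun n ↦ ?_
  rw [jacobiTheta₂_term, th3Term, twoPiI]
  ring_nf

lemma summable_norm_th2Term {τ : ℂ} (hτ : 0 < τ.im) (z : ℂ) :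
    Summable fun n ↦ ‖th2Term τ z n‖ := by
  have h := (summable_norm_th3Term hτ (z + τ / 2)).mul_left ‖exp (twoPiI * (z / 2 + τ / 8))‖
  refine h.congr fun n ↦ ?_
  rw [← norm_mul, th3Term, th2Term, ← Complex.exp_add]
  ring_nf

lemma norm_neg_one_zpow_mul (n : ℤ) (w : ℂ) : ‖(-1 : ℂ) ^ n * w‖ = ‖w‖ := by
  simp

lemma th3_mul_th3_zero {τ : ℂ} (hτ : 0 < τ.im) (z : ℂ) :
    th3 τ z * th3 τ 0 = th3 (2 * τ) z ^ 2 + th2 (2 * τ) z ^ 2 := by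
  have hτ2 : 0 < (2 * τ).im := by simpa using hτ
  have hz := summable_norm_th3Term hτ z
  have h0 := summable_norm_th3Term hτ 0
  have h3 := summable_norm_th3Term hτ2 z
  have h2 := summable_norm_th2Term hτ2 z
  change (∑' n, th3Term τ z n) * (∑' n, th3Term τ 0 n) =
    (∑' n, th3Term (2 * τ) z n) ^ 2 + (∑' n, th2Term (2 * τ) z n) ^ 2
  rw [sq, sq, tsum_mul_tsum_of_summable_norm hz h0, tsum_mul_tsum_of_summable_norm h3 h3,
    tsum_mul_tsum_of_summable_norm h2 h2,
    tsum_int_prod_eq_parity (summable_mul_of_summable_norm hz h0)]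
  congr 1 <;> refine tsum_congr fun x ↦ ?_ <;>
    simp only [th3Term, th2Term, ← Complex.exp_add] <;> push_cast <;> ring_nf

lemma th4_mul_th4_zero {τ : ℂ} (hτ : 0 < τ.im) (z : ℂ) :
    th4 τ z * th4 τ 0 = th3 (2 * τ) z ^ 2 - th2 (2 * τ) z ^ 2 := by
  have hτ2 : 0 < (2 * τ).im := by simpa using hτ
  have hz : Summable fun n ↦ ‖(-1 : ℂ) ^ n * th3Term τ z n‖ := by
    simpa only [norm_neg_one_zpow_mul] using summable_norm_th3Term hτ z
  have h0 : Summable fun n ↦ ‖(-1 : ℂ) ^ n * th3Term τ 0 n‖ := by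
    simpa only [norm_neg_one_zpow_mul] using summable_norm_th3Term hτ 0
  have h3 := summable_norm_th3Term hτ2 z
  have h2 := summable_norm_th2Term hτ2 z
  change (∑' n, (-1 : ℂ) ^ n * th3Term τ z n) * (∑' n, (-1 : ℂ) ^ n * th3Term τ 0 n) =
    (∑' n, th3Term (2 * τ) z n) ^ 2 - (∑' n, th2Term (2 * τ) z n) ^ 2
  rw [sq, sq, tsum_mul_tsum_of_summable_norm hz h0, tsum_mul_tsum_of_summable_norm h3 h3,
    tsum_mul_tsum_of_summable_norm h2 h2,
    tsum_int_prod_eq_parity (summable_mul_of_summable_norm hz h0), sub_eq_add_neg, ← tsum_neg]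
  congr 1 <;> refine tsum_congr fun ⟨a, b⟩ ↦ ?_
  · have hs : (-1 : ℂ) ^ (a + b) * (-1) ^ (a - b) = 1 := by
      rw [← zpow_add₀ (by norm_num)]
      exact Even.neg_one_zpow ⟨a, by ring⟩
    rw [mul_mul_mul_comm, hs, one_mul]
    simp only [th3Term, ← Complex.exp_add]
    push_cast
    ring_nf
  · have hs : (-1 : ℂ) ^ (a + b + 1) * (-1) ^ (a - b) = -1 := by
      rw [← zpow_add₀ (by norm_num)]
      exact Odd.neg_one_zpow ⟨a, by ring⟩
    rw [mul_mul_mul_comm, hs, neg_one_mul]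
    simp only [th3Term, th2Term, ← Complex.exp_add]
    push_cast
    ring_nf

lemma th2_mul_th2_zero {τ : ℂ} (hτ : 0 < τ.im) (z : ℂ) :
    th2 τ z * th2 τ 0 = 2 * (th3 (2 * τ) z * th2 (2 * τ) z) := by
  have hτ2 : 0 < (2 * τ).im := by simpa using hτ
  have hz := summable_norm_th2Term hτ z
  have h0 := summable_norm_th2Term hτ 0
  have h3 := summable_norm_th3Term hτ2 z
  have h2 := summable_norm_th2Term hτ2 z
  have h3' : Summable fun n ↦ ‖th3Term (2 * τ) z (n + 1)‖ :=
    (Equiv.addRight (1 : ℤ)).summable_iff.mpr h3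
  have hshift : ∑' n, th3Term (2 * τ) z (n + 1) = ∑' n, th3Term (2 * τ) z n :=
    (Equiv.addRight (1 : ℤ)).tsum_eq (th3Term (2 * τ) z)
  change (∑' n, th2Term τ z n) * (∑' n, th2Term τ 0 n) =
    2 * ((∑' n, th3Term (2 * τ) z n) * (∑' n, th2Term (2 * τ) z n))
  rw [two_mul]
  nth_rw 2 [← hshift]
  rw [mul_comm (∑' n, th3Term (2 * τ) z n), tsum_mul_tsum_of_summable_norm hz h0,
    tsum_mul_tsum_of_summable_norm h2 h3, tsum_mul_tsum_of_summable_norm h3' h2,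
    tsum_int_prod_eq_parity (summable_mul_of_summable_norm hz h0)]
  congr 1 <;> refine tsum_congr fun x ↦ ?_ <;>
    simp only [th3Term, th2Term, ← Complex.exp_add] <;> push_cast <;> ring_nf

/-- The quadratic relation between the squares of the even theta functions. -/
lemma th2_sq_add_th4_sq {τ : ℂ} (hτ : 0 < τ.im) (z : ℂ) :
    th2 τ z ^ 2 * th2 τ 0 ^ 2 + th4 τ z ^ 2 * th4 τ 0 ^ 2 = th3 τ z ^ 2 * th3 τ 0 ^ 2 := by
  rw [← mul_pow, ← mul_pow, ← mul_pow, th2_mul_th2_zero hτ, th4_mul_th4_zero hτ,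
    th3_mul_th3_zero hτ]
  ring

/-- The terms of `ϑ₃(τ, 0)` in the nome `e^{πiτ} = qq (τ / 2)`. -/
lemma th3Term_zero (τ : ℂ) (n : ℤ) : th3Term τ 0 n = qq (τ / 2) ^ n ^ 2 := by
  rw [th3Term, qq, ← Complex.exp_int_mul]
  push_cast
  ring_nf

lemma th2Term_zero (τ : ℂ) (n : ℤ) :
    th2Term τ 0 n = exp (twoPiI * τ / 8) * (qq (τ / 2) ^ n ^ 2 * qq (τ / 2) ^ n) := by
  rw [th2Term, qq, ← Complex.exp_int_mul, ← Complex.exp_int_mul, ← Complex.exp_add,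
    ← Complex.exp_add]
  push_cast
  ring_nf

lemma norm_qq_lt_one {τ : ℂ} (hτ : 0 < τ.im) : ‖qq τ‖ < 1 := by
  rw [qq, Complex.norm_exp, Real.exp_lt_one_iff]
  simp [twoPiI]
  positivity

lemma im_half_pos {τ : ℂ} (hτ : 0 < τ.im) : 0 < (τ / 2).im := by
  simpa using hτ

lemma qq_half_sq (τ : ℂ) : qq (τ / 2) ^ 2 = qq τ := by
  rw [qq, qq, ← Complex.exp_nat_mul]
  push_cast
  ring_nf

lemma qq_half_pow_four (τ : ℂ) : qq (τ / 2) ^ 4 = qq (2 * τ) := by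
  rw [qq, qq, ← Complex.exp_nat_mul]
  push_cast
  ring_nf

lemma etaF_eq (τ : ℂ) : etaF τ = exp (twoPiI * τ / 24) * eulerProd (qq τ) := rfl

lemma etaF_ne_zero {τ : ℂ} (hτ : 0 < τ.im) : etaF τ ≠ 0 :=
  mul_ne_zero (Complex.exp_ne_zero _) (eulerProd_ne_zero (norm_qq_lt_one hτ))

lemma th4_zero_mul_etaF {τ : ℂ} (hτ : 0 < τ.im) : th4 τ 0 * etaF τ = etaF (τ / 2) ^ 2 := by
  have hs : Summable fun k : ℤ ↦ ‖qq (τ / 2) ^ k ^ 2 * (-1 : ℂ) ^ k‖ := by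
    refine (summable_norm_th3Term hτ 0).congr fun k ↦ ?_
    rw [mul_comm, norm_neg_one_zpow_mul, th3Term_zero]
  have h := tsum_neg_one_eulerProd (p := qq (τ / 2)) (Complex.exp_ne_zero _) (norm_qq_lt_one (im_half_pos hτ)) hs
  have hth : th4 τ 0 = ∑' k : ℤ, qq (τ / 2) ^ k ^ 2 * (-1 : ℂ) ^ k :=
    tsum_congr fun k ↦ by rw [← th3Term_zero, mul_comm, th3Term]
  have he : exp (twoPiI * τ / 24) = exp (twoPiI * (τ / 2) / 24) ^ 2 := by
    rw [← Complex.exp_nat_mul]; push_cast; ring_nf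
  rw [qq_half_sq] at h
  rw [hth, etaF_eq, etaF_eq, he]
  linear_combination exp (twoPiI * (τ / 2) / 24) ^ 2 * h

lemma th3_zero_mul_etaF {τ : ℂ} (hτ : 0 < τ.im) :
    th3 τ 0 * (etaF (τ / 2) ^ 2 * etaF (2 * τ) ^ 2) = etaF τ ^ 5 := by
  have hs : Summable fun k : ℤ ↦ ‖qq (τ / 2) ^ k ^ 2 * (1 : ℂ) ^ k‖ := by
    refine (summable_norm_th3Term hτ 0).congr fun k ↦ ?_
    rw [one_zpow, mul_one, th3Term_zero]
  have h := tsum_one_eulerProd (p := qq (τ / 2)) (Complex.exp_ne_zero _) (norm_qq_lt_one (im_half_pos hτ)) hs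
  have hth : th3 τ 0 = ∑' k : ℤ, qq (τ / 2) ^ k ^ 2 * (1 : ℂ) ^ k :=
    tsum_congr fun k ↦ by rw [← th3Term_zero, one_zpow, mul_one, th3Term]
  have he : exp (twoPiI * τ / 24) ^ 5 =
      exp (twoPiI * (τ / 2) / 24) ^ 2 * exp (twoPiI * (2 * τ) / 24) ^ 2 := by
    simp only [← Complex.exp_nat_mul, ← Complex.exp_add]; push_cast; ring_nf
  rw [qq_half_sq, qq_half_pow_four] at h
  rw [hth, etaF_eq, etaF_eq, etaF_eq, mul_pow _ _ 5, he]
  linear_combination exp (twoPiI * (τ / 2) / 24) ^ 2 * exp (twoPiI * (2 * τ) / 24) ^ 2 * h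

lemma th2_zero_mul_etaF {τ : ℂ} (hτ : 0 < τ.im) :
    th2 τ 0 * etaF τ = 2 * etaF (2 * τ) ^ 2 := by
  have hs : Summable fun k : ℤ ↦ ‖qq (τ / 2) ^ k ^ 2 * qq (τ / 2) ^ k‖ := by
    refine ((summable_norm_th2Term hτ 0).mul_left ‖exp (twoPiI * τ / 8)‖⁻¹).congr fun k ↦ ?_
    rw [th2Term_zero, norm_mul, inv_mul_cancel_left₀ (by simp)]
  have h := tsum_self_eulerProd (p := qq (τ / 2)) (Complex.exp_ne_zero _) (norm_qq_lt_one (im_half_pos hτ)) hs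
  have hth : th2 τ 0 = exp (twoPiI * τ / 8) * ∑' k : ℤ, qq (τ / 2) ^ k ^ 2 * qq (τ / 2) ^ k := by
    rw [← tsum_mul_left]
    exact tsum_congr fun k ↦ by rw [← th2Term_zero, th2Term]
  have he : exp (twoPiI * (2 * τ) / 24) ^ 2 = exp (twoPiI * τ / 8) * exp (twoPiI * τ / 24) := by
    simp only [← Complex.exp_nat_mul, ← Complex.exp_add]; push_cast; ring_nf
  rw [qq_half_sq, qq_half_pow_four] at h
  rw [hth, etaF_eq, etaF_eq, mul_pow, he]
  linear_combination exp (twoPiI * τ / 8) * exp (twoPiI * τ / 24) * h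

/-- The algebraic core of the K3 formula: `u, v, w` stand for `η(τ/2), η(τ), η(2τ)`, `a, b, c` for
the theta constants, and `A, B, C` for the squared theta quotients. -/
lemma theta_quotient_identity {u v w a b c A B C : ℂ} (hu : u ≠ 0) (hv : v ≠ 0) (hw : w ≠ 0)
    (ha : a * v = 2 * w ^ 2) (hb : b * (u ^ 2 * w ^ 2) = v ^ 5) (hc : c * v = u ^ 2)
    (habc : a ^ 4 + c ^ 4 = b ^ 4) (hABC : A * a ^ 4 + C * c ^ 4 = B * b ^ 4) :
    2 * (4 * (A + B + C)) =
      1 / 2 * B * ((v ^ 24) ^ 2 / (w ^ 24 * u ^ 24)) - 1 / 2 * C * (u ^ 24 / v ^ 24) -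
        2 ^ 11 * A * (w ^ 24 / v ^ 24) := by
  have ha0 : a ≠ 0 := by rintro rfl; simp [hw] at ha
  have hb0 : b ≠ 0 := by
    rintro rfl
    rw [zero_mul] at hb
    exact pow_ne_zero 5 hv hb.symm
  have hc0 : c ≠ 0 := by
    rintro rfl
    rw [zero_mul] at hc
    exact pow_ne_zero 2 hu hc.symm
  have hv12 : v ^ 12 = (a * b * c) ^ 4 / 16 := by
    have h : a * b * c = 2 * v ^ 3 := by
      refine mul_right_cancel₀ (b := v ^ 2 * (u ^ 2 * w ^ 2)) (by simp [hu, hv, hw]) ?_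
      linear_combination (b * c * v * (u ^ 2 * w ^ 2)) * ha + (2 * w ^ 2 * c * v) * hb +
        2 * w ^ 2 * v ^ 5 * hc
    rw [h]; ring
  have h2 : w ^ 24 / v ^ 24 = a ^ 12 / (2 ^ 12 * v ^ 12) := by
    rw [div_eq_div_iff (by simp [hv]) (by simp [hv])]
    have := congrArg (· ^ 12) ha
    simp only [mul_pow] at this
    linear_combination (-v ^ 12) * this
  have h4 : u ^ 24 / v ^ 24 = c ^ 12 / v ^ 12 := by
    rw [div_eq_div_iff (by simp [hv]) (by simp [hv])]
    have := congrArg (· ^ 12) hc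
    simp only [mul_pow] at this
    linear_combination (-v ^ 12) * this
  have h3 : (v ^ 24) ^ 2 / (w ^ 24 * u ^ 24) = b ^ 12 / v ^ 12 := by
    rw [div_eq_div_iff (by simp [hu, hw]) (by simp [hv])]
    have := congrArg (· ^ 12) hb
    simp only [mul_pow] at this
    linear_combination -this
  rw [h2, h3, h4, hv12]
  have ha12 : a ^ 12 = (a ^ 4) ^ 3 := by ring
  have hb12 : b ^ 12 = (b ^ 4) ^ 3 := by ring
  have hc12 : c ^ 12 = (c ^ 4) ^ 3 := by ring
  rw [mul_pow, mul_pow, ha12, hb12, hc12]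
  have ha4 := pow_ne_zero 4 ha0
  have hb4 := pow_ne_zero 4 hb0
  have hc4 := pow_ne_zero 4 hc0
  generalize a ^ 4 = α at *
  generalize b ^ 4 = β at *
  generalize c ^ 4 = γ at *
  subst habc
  field_simp
  linear_combination 16 * ((α + γ) ^ 2 - α * γ) * hABC

/-- The K3 elliptic genus `Z_{K3} = 2·φ_{0,1}` expressed via theta quotients and `Δ`. -/
theorem K3_elliptic_genus_formula :
    ∀ τ z : ℂ, 0 < τ.im →
      2 * phi01 τ z =
        1 / 2 * (th3 τ z ^ 2 / th3 τ 0 ^ 2) * (Delta τ ^ 2 / (Delta (2 * τ) * Delta (τ / 2)))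
        - 1 / 2 * (th4 τ z ^ 2 / th4 τ 0 ^ 2) * (Delta (τ / 2) / Delta τ)
        - 2 ^ 11 * (th2 τ z ^ 2 / th2 τ 0 ^ 2) * (Delta (2 * τ) / Delta τ) := by
  intro τ z hτ
  have h0 := th2_sq_add_th4_sq hτ 0
  have hz := th2_sq_add_th4_sq hτ z
  have hu := etaF_ne_zero (im_half_pos hτ)
  have hv := etaF_ne_zero hτ
  have hw := etaF_ne_zero (τ := 2 * τ) (by simpa using hτ)
  have ha := th2_zero_mul_etaF hτ
  have hb := th3_zero_mul_etaF hτ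
  have hc := th4_zero_mul_etaF hτ
  have ha0 : th2 τ 0 ≠ 0 := fun h ↦ by simp [h, hw] at ha
  have hb0 : th3 τ 0 ≠ 0 := fun h ↦ pow_ne_zero 5 hv (by rw [← hb, h, zero_mul])
  have hc0 : th4 τ 0 ≠ 0 := fun h ↦ pow_ne_zero 2 hu (by rw [← hc, h, zero_mul])
  refine theta_quotient_identity hu hv hw ha hb hc (by linear_combination h0) ?_
  field_simp
  linear_combination hz
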